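/- Let e_I^i and ω_i^I (I, i ∈ {1, 2, 3}) be real-valued functions on 𝕋³, with each e_I^i continuously differentiable, such that: (i) ω_a^I e_J^a = δ_J^I pointwise (sum over a = 1, 2, 3, δ the Kronecker delta); (ii) e_1^3 = e_2^3 = e_3^1 = e_3^2 ≡ 0 and ω_1^3 = ω_2^3 = ω_3^1 = ω_3^2 ≡ 0; (iii) e_3^c ∂_c e_I^i ≡ 0 for all I, i. Define, for I, J, B ∈ {1, 2, 3}, γ_{IJB} := ½ { ω_c^B (e_I e_J^c − e_J e_I^c) − ω_c^I (e_J e_B^c − e_B e_J^c) + ω_c^J (e_B e_I^c − e_I e_B^c) }, where e_I f := e_I^c ∂_c f (sum over c = 1, 2, 3). Then γ_{123} = γ_{231} = γ_{312} ≡ 0; consequently, using the antisymmetry γ_{IJB} = −γ_{IBJ} satisfied identically by this formula, γ_{IJB} + γ_{JBI} ≡ 0 whenever I = J or whenever I, J, B are pairwise distinct. (The computational content of the paper's Lemma 2.4 and equation (2.35): in polarized U(1) symmetry, the spatial connection coefficients with three distinct indices vanish.) -/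

import Mathlib

noncomputable section

/-- `v` is `ℤ³`-periodic: models a function on the torus `𝕋³ = (ℝ/ℤ)³`. -/
def TorusFun (v : (Fin 3 → ℝ) → ℝ) : Prop :=
  ∀ (x : Fin 3 → ℝ) (i : Fin 3), v (x + Pi.single i 1) = v x

/-- Coordinate partial derivative `∂_i v`. -/
def pd (i : Fin 3) (v : (Fin 3 → ℝ) → ℝ) : (Fin 3 → ℝ) → ℝ :=
  fun x => fderiv ℝ v x (Pi.single i 1)

/-- Frame derivative `e_I f := e_I^c ∂_c f` (sum over `c`). -/
def frameDer (e : Fin 3 → Fin 3 → (Fin 3 → ℝ) → ℝ) (I : Fin 3)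
    (f : (Fin 3 → ℝ) → ℝ) : (Fin 3 → ℝ) → ℝ :=
  fun x => ∑ c : Fin 3, e I c x * pd c f x

/-- The connection coefficients `γ_{IJB}` of the frame, via the paper's formula (2.26):
`γ_{IJB} = ½ { ω_c^B (e_I e_J^c − e_J e_I^c) − ω_c^I (e_J e_B^c − e_B e_J^c)
+ ω_c^J (e_B e_I^c − e_I e_B^c) }`. Here `e I i` is `e_I^i` and `ω I i` is `ω_i^I`. -/
def conn (e ω : Fin 3 → Fin 3 → (Fin 3 → ℝ) → ℝ) (I J B : Fin 3) :
    (Fin 3 → ℝ) → ℝ :=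
  fun x => (1 / 2) *
    ((∑ c : Fin 3, ω B c x * (frameDer e I (e J c) x - frameDer e J (e I c) x))
      - (∑ c : Fin 3, ω I c x * (frameDer e J (e B c) x - frameDer e B (e J c) x))
      + (∑ c : Fin 3, ω J c x * (frameDer e B (e I c) x - frameDer e I (e B c) x)))

theorem pd_of_forall_eq_zero {v : (Fin 3 → ℝ) → ℝ} (hv : ∀ x, v x = 0) (i : Fin 3)
    (x : Fin 3 → ℝ) : pd i v x = 0 := by
  obtain rfl : v = fun _ => 0 := funext hv
  simp [pd]

theorem frameDer_of_forall_eq_zero (e : Fin 3 → Fin 3 → (Fin 3 → ℝ) → ℝ) (I : Fin 3)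
    {v : (Fin 3 → ℝ) → ℝ} (hv : ∀ x, v x = 0) (x : Fin 3 → ℝ) : frameDer e I v x = 0 := by
  simp [frameDer, pd_of_forall_eq_zero hv]

/-- Antisymmetry of the connection coefficients in their last two indices. -/
theorem conn_swap (e ω : Fin 3 → Fin 3 → (Fin 3 → ℝ) → ℝ) (I J B : Fin 3) (x : Fin 3 → ℝ) :
    conn e ω I J B x = -conn e ω I B J x := by
  simp only [conn, Fin.sum_univ_three]
  ring

/-- **Vanishing of the connection coefficients with three distinct indices in polarized
`U(1)` symmetry** (the computational content of the paper's Lemma 2.4 and equation (2.35)).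
Indices are zero-based: `0, 1, 2` stand for the paper's `1, 2, 3`. Hypotheses: (i) duality
of frame and co-frame; (ii) `e_1^3 = e_2^3 = e_3^1 = e_3^2 = 0` and
`ω_1^3 = ω_2^3 = ω_3^1 = ω_3^2 = 0`; (iii) `e_3 e_I^i = 0` for all `I, i`.
Conclusions: `γ_{123} = γ_{231} = γ_{312} = 0`, and the structure coefficients
`γ_{IJB} + γ_{JBI}` vanish whenever `I = J` or `I, J, B` are pairwise distinct. -/
theorem stmt17 (e ω : Fin 3 → Fin 3 → (Fin 3 → ℝ) → ℝ)
    (heC1 : ∀ I i, ContDiff ℝ 1 (e I i))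
    (heP : ∀ I i, TorusFun (e I i)) (hωP : ∀ I i, TorusFun (ω I i))
    (hdual : ∀ I J x, (∑ a : Fin 3, ω I a x * e J a x) = if I = J then (1 : ℝ) else 0)
    (he13 : ∀ x, e 0 2 x = 0) (he23 : ∀ x, e 1 2 x = 0)
    (he31 : ∀ x, e 2 0 x = 0) (he32 : ∀ x, e 2 1 x = 0)
    (hω13 : ∀ x, ω 2 0 x = 0) (hω23 : ∀ x, ω 2 1 x = 0)
    (hω31 : ∀ x, ω 0 2 x = 0) (hω32 : ∀ x, ω 1 2 x = 0)
    (hKilling : ∀ I i x, (∑ c : Fin 3, e 2 c x * pd c (e I i) x) = 0) :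
    (∀ x, conn e ω 0 1 2 x = 0 ∧ conn e ω 1 2 0 x = 0 ∧ conn e ω 2 0 1 x = 0) ∧
    (∀ I J B : Fin 3, ∀ x, (I = J ∨ (I ≠ J ∧ J ≠ B ∧ I ≠ B)) →
      conn e ω I J B x + conn e ω J B I x = 0) := by
  have hfd : ∀ I i x, frameDer e 2 (e I i) x = 0 := hKilling
  have h012 : ∀ x, conn e ω 0 1 2 x = 0 ∧ conn e ω 1 2 0 x = 0 ∧ conn e ω 2 0 1 x = 0 := by
    intro x
    simp [conn, Fin.sum_univ_three, hfd, hω13, hω23, hω31, hω32,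
      frameDer_of_forall_eq_zero e _ he13, frameDer_of_forall_eq_zero e _ he23,
      frameDer_of_forall_eq_zero e _ he31, frameDer_of_forall_eq_zero e _ he32]
  refine ⟨h012, ?_⟩
  rintro I J B x (rfl | ⟨hIJ, hJB, hIB⟩)
  · rw [conn_swap, neg_add_cancel]
  · obtain ⟨h0, h1, h2⟩ := h012 x
    have h0' : conn e ω 0 2 1 x = 0 := by rw [conn_swap, h0, neg_zero]
    have h1' : conn e ω 1 0 2 x = 0 := by rw [conn_swap, h1, neg_zero]
    have h2' : conn e ω 2 1 0 x = 0 := by rw [conn_swap, h2, neg_zero]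
    fin_cases I <;> fin_cases J <;> fin_cases B <;> simp_all
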